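/- Fix natural numbers D ≥ 1 and N ≥ 1. Let R = ℚ[λ_{u,v} : u ∈ Fin D, v ∈ Fin N] be a polynomial ring, and in R[w,t] set Σ = ∏_{u∈Fin D} ( w − ∏_{v∈Fin N} (t − λ_{u,v}) ). For 0 ≤ i ≤ D and 0 ≤ j ≤ N·i, define σ_{i,j} ∈ R by σ_{i,j} = (−1)^{i+j} · (the coefficient of w^{D−i} t^{N·i−j} in Σ). Then each σ_{i,j} is invariant under the wreath product action of S_N ≀ S_D: for every permutation π of Fin D and every family τ : Fin D → Perm(Fin N), the ℚ-algebra automorphism of R determined by λ_{u,v} ↦ λ_{π(u), (τ u)(v)} sends σ_{i,j} to itself. -/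

import Mathlib

open MvPolynomial

/-- `Σ = ∏_{u ∈ Fin D} (w - ∏_{v ∈ Fin N} (t - λ_{u,v}))`, as a polynomial in the two
variables `w = X 0`, `t = X 1` over `R = ℚ[λ_{u,v}]`. -/
noncomputable def SigmaPoly (D N : ℕ) :
    MvPolynomial (Fin 2) (MvPolynomial (Fin D × Fin N) ℚ) :=
  ∏ u : Fin D, (X 0 - ∏ v : Fin N, (X 1 - C (X (u, v))))

/-- The multiplier invariant `σ_{i,j} = (-1)^(i+j) ·` (coefficient of
`w^(D-i) t^(N·i-j)` in `Σ`). -/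
noncomputable def sigmaInv (D N i j : ℕ) : MvPolynomial (Fin D × Fin N) ℚ :=
  (-1) ^ (i + j) *
    MvPolynomial.coeff (Finsupp.single 0 (D - i) + Finsupp.single 1 (N * i - j))
      (SigmaPoly D N)

theorem map_rename_SigmaPoly {D N : ℕ} (π : Equiv.Perm (Fin D))
    (τ : Fin D → Equiv.Perm (Fin N)) :
    MvPolynomial.map
        (MvPolynomial.rename (R := ℚ)
          (fun p : Fin D × Fin N => (π p.1, (τ p.1) p.2))).toRingHom
        (SigmaPoly D N) =
      SigmaPoly D N := by
  simp only [SigmaPoly, map_prod, map_sub, map_X, map_C, AlgHom.toRingHom_eq_coe,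
    RingHom.coe_coe, rename_X]
  rw [← Equiv.prod_comp π (fun u => X 0 - ∏ v : Fin N, (X 1 - C (X (u, v))))]
  refine Finset.prod_congr rfl fun u _ => ?_
  rw [← Equiv.prod_comp (τ u) (fun v => X 1 - C (X (π u, v)))]

/-- The multiplier invariants `σ_{i,j}` are invariant under the wreath product
action of `S_N ≀ S_D` on the variables: for every permutation `π` of `Fin D` and
family `τ : Fin D → Perm (Fin N)`, the ℚ-algebra automorphism determined by
`λ_{u,v} ↦ λ_{π u, (τ u) v}` fixes each `σ_{i,j}`. -/
theorem sigmaInv_wreath_invariant (D N : ℕ) (hD : 1 ≤ D) (hN : 1 ≤ N)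
    (π : Equiv.Perm (Fin D)) (τ : Fin D → Equiv.Perm (Fin N))
    (i j : ℕ) (hi : i ≤ D) (hj : j ≤ N * i) :
    MvPolynomial.rename (fun p : Fin D × Fin N => (π p.1, (τ p.1) p.2))
        (sigmaInv D N i j) =
      sigmaInv D N i j := by
  rw [sigmaInv, map_mul, map_pow, map_neg, map_one]
  conv_rhs => rw [← map_rename_SigmaPoly π τ, coeff_map]
  rfl
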